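/- arXiv:1507.06541 — 4 statements merged into one kernel-verified Lean document; each statement's English description precedes it below -/
import Mathlib

section
/- If a finite graph G has a dominating induced matching, then G is K_4-free, gem-free, and for every k ≥ 6 G contains no induced subgraph isomorphic to the complement of the chordless cycle C_k. -/
open SimpleGraph

/-- `M` is a dominating induced matching (d.i.m.) of `G`: every edge of `G` shares an
endpoint with exactly one edge of `M`. -/
def IsDIM {V : Type*} (G : SimpleGraph V) (M : Set (Sym2 V)) : Prop :=
  M ⊆ G.edgeSet ∧ ∀ e ∈ G.edgeSet, ∃! f, f ∈ M ∧ ∃ v, v ∈ e ∧ v ∈ f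

/-- `V(M)`: the set of endpoints of edges of `M`. -/
def MVerts {V : Type*} (M : Set (Sym2 V)) : Set V := {v | ∃ e ∈ M, v ∈ e}

/-- The distance level `N_i(xy) = {z | dist(z,{x,y}) = i}`. -/
def distLevel {V : Type*} (G : SimpleGraph V) (x y : V) (i : ℕ) : Set V :=
  {z : V | min (G.dist z x) (G.dist z y) = i}

/-- `c` lists the vertices of a chordless (induced) cycle of length `n` in `G`. -/
def IsInducedCycle {V : Type*} (G : SimpleGraph V) (n : ℕ) (c : ZMod n → V) : Prop :=
  Function.Injective c ∧ ∀ i j : ZMod n, G.Adj (c i) (c j) ↔ (j = i + 1 ∨ i = j + 1)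

/-- The diamond: vertices 0,1,2,3 and edges 01,02,12,13,23 (mid-edge 12). -/
def diamondGraph : SimpleGraph (Fin 4) :=
  SimpleGraph.fromEdgeSet {s(0,1), s(0,2), s(1,2), s(1,3), s(2,3)}

/-- The butterfly: vertices 0,1,2,3,4 and edges 01,02,12,23,24,34. -/
def butterflyGraph : SimpleGraph (Fin 5) :=
  SimpleGraph.fromEdgeSet {s(0,1), s(0,2), s(1,2), s(2,3), s(2,4), s(3,4)}

/-- The gem: a path 0-1-2-3 plus the universal vertex 4. -/
def gemGraph : SimpleGraph (Fin 5) :=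
  SimpleGraph.fromEdgeSet {s(0,1), s(1,2), s(2,3), s(4,0), s(4,1), s(4,2), s(4,3)}

/-- `T_w`: the vertices of `N_3(xy)` whose neighborhood in `N_2(xy)` is exactly `{w}`. -/
def Tset {V : Type*} (G : SimpleGraph V) (x y : V) (w : V) : Set V :=
  {t | t ∈ distLevel G x y 3 ∧ G.neighborSet t ∩ distLevel G x y 2 = {w}}

/-- The vertices distinct from and nonadjacent to both `t1` and `t2`
(the vertex set of `G'`). -/
def avoidSet {V : Type*} (G : SimpleGraph V) (t1 t2 : V) : Set V :=
  {v | v ≠ t1 ∧ v ≠ t2 ∧ ¬ G.Adj v t1 ∧ ¬ G.Adj v t2}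

/-- A matching edge joins any two adjacent endpoints of matching edges. -/
lemma IsDIM.mem_of_adj {V : Type*} {G : SimpleGraph V} {M : Set (Sym2 V)} (hM : IsDIM G M)
    {u v : V} (h : G.Adj u v) (hu : u ∈ MVerts M) (hv : v ∈ MVerts M) : s(u, v) ∈ M := by
  obtain ⟨f, hf, huf⟩ := hu
  obtain ⟨g, hg, hvg⟩ := hv
  have hfg : f = g := (hM.2 s(u, v) h).unique
    ⟨hf, u, Sym2.mem_mk_left u v, huf⟩ ⟨hg, v, Sym2.mem_mk_right u v, hvg⟩
  subst hfg
  rwa [← (Sym2.mem_and_mem_iff h.ne).1 ⟨huf, hvg⟩]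

/-- The vertices not covered by a dominating induced matching are independent. -/
lemma IsDIM.mem_or_mem {V : Type*} {G : SimpleGraph V} {M : Set (Sym2 V)} (hM : IsDIM G M)
    {u v : V} (h : G.Adj u v) : u ∈ MVerts M ∨ v ∈ MVerts M := by
  obtain ⟨f, ⟨hf, w, hw, hwf⟩, -⟩ := hM.2 s(u, v) h
  rcases Sym2.mem_iff.1 hw with rfl | rfl
  · exact Or.inl ⟨f, hf, hwf⟩
  · exact Or.inr ⟨f, hf, hwf⟩

/-- A covered vertex has at most one covered neighbor. -/
lemma IsDIM.eq_of_adj_of_adj {V : Type*} {G : SimpleGraph V} {M : Set (Sym2 V)}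
    (hM : IsDIM G M) {u v w : V} (huv : G.Adj u v) (huw : G.Adj u w) (hu : u ∈ MVerts M)
    (hv : v ∈ MVerts M) (hw : w ∈ MVerts M) : v = w :=
  Sym2.congr_right.1 <| (hM.2 s(u, v) huv).unique
    ⟨hM.mem_of_adj huv hu hv, u, Sym2.mem_mk_left u v, Sym2.mem_mk_left u v⟩
    ⟨hM.mem_of_adj huw hu hw, u, Sym2.mem_mk_left u v, Sym2.mem_mk_left u w⟩

lemma cycleGraph_compl_adj_of_add_two_le {m i j : ℕ} (hi : i < m + 6) (hj : j < m + 6)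
    (hij : i + 2 ≤ j) (hji : j < i + m + 5) :
    (SimpleGraph.cycleGraph (m + 6))ᶜ.Adj ⟨i, hi⟩ ⟨j, hj⟩ := by
  rw [SimpleGraph.compl_adj, SimpleGraph.cycleGraph_adj']
  refine ⟨by simp only [ne_eq, Fin.mk.injEq]; omega, ?_⟩
  rw [Fin.coe_sub_iff_lt.2 (by simp only [Fin.lt_def]; omega),
    Fin.coe_sub_iff_le.2 (by simp only [Fin.le_def]; omega)]
  dsimp only
  omega

/-- a graph having a d.i.m. is K₄-free, gem-free and
(complement of C_k)-free for all k ≥ 6. -/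
theorem stmt3 {V : Type*} [Fintype V] (G : SimpleGraph V)
    (hdim : ∃ M : Set (Sym2 V), IsDIM G M) :
    IsEmpty ((⊤ : SimpleGraph (Fin 4)) ↪g G) ∧
    IsEmpty (gemGraph ↪g G) ∧
    ∀ k : ℕ, 6 ≤ k → IsEmpty ((SimpleGraph.cycleGraph k)ᶜ ↪g G) := by
  obtain ⟨M, hM⟩ := hdim
  have cover := fun u v => hM.mem_or_mem (u := u) (v := v)
  have uniq := fun u v w => hM.eq_of_adj_of_adj (u := u) (v := v) (w := w)
  refine ⟨⟨fun φ => ?_⟩, ⟨fun φ => ?_⟩, fun k hk => ⟨fun φ => ?_⟩⟩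
  · have adj : ∀ i j : Fin 4, i ≠ j → G.Adj (φ i) (φ j) := fun i j h => φ.map_rel_iff.2 h
    have h03 := adj 0 3 (by decide)
    have h13 := adj 1 3 (by decide)
    have h23 := adj 2 3 (by decide)
    grind [SimpleGraph.Adj.ne, SimpleGraph.Adj.symm]
  · have adj : ∀ i j : Fin 5, gemGraph.Adj i j → G.Adj (φ i) (φ j) :=
      fun i j h => φ.map_rel_iff.2 h
    have h01 := adj 0 1 (by simp [gemGraph])
    have h12 := adj 1 2 (by simp [gemGraph])
    have h23 := adj 2 3 (by simp [gemGraph])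
    have h40 := adj 4 0 (by simp [gemGraph])
    have h41 := adj 4 1 (by simp [gemGraph])
    have h42 := adj 4 2 (by simp [gemGraph])
    have h43 := adj 4 3 (by simp [gemGraph])
    have inj := φ.injective
    grind [SimpleGraph.Adj.ne, SimpleGraph.Adj.symm]
  · obtain ⟨m, rfl⟩ := Nat.exists_eq_add_of_le' hk
    have adj : ∀ i j : ℕ, ∀ (hi : i < m + 6) (hj : j < m + 6), i + 2 ≤ j → j < i + 5 →
        G.Adj (φ ⟨i, hi⟩) (φ ⟨j, hj⟩) := fun i j hi hj hij hji =>
      φ.map_rel_iff.2 (cycleGraph_compl_adj_of_add_two_le hi hj hij (by omega))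
    have ne : ∀ i j : ℕ, ∀ (hi : i < m + 6) (hj : j < m + 6), i ≠ j →
        φ ⟨i, hi⟩ ≠ φ ⟨j, hj⟩ := fun i j hi hj hij =>
      φ.injective.ne (by simpa using hij)
    -- The first six vertices span a triangular prism.
    have h02 := adj 0 2 (by omega) (by omega) (by omega) (by omega)
    have h04 := adj 0 4 (by omega) (by omega) (by omega) (by omega)
    have h24 := adj 2 4 (by omega) (by omega) (by omega) (by omega)
    have h13 := adj 1 3 (by omega) (by omega) (by omega) (by omega)
    have h15 := adj 1 5 (by omega) (by omega) (by omega) (by omega)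
    have h35 := adj 3 5 (by omega) (by omega) (by omega) (by omega)
    have h03 := adj 0 3 (by omega) (by omega) (by omega) (by omega)
    have h14 := adj 1 4 (by omega) (by omega) (by omega) (by omega)
    have h25 := adj 2 5 (by omega) (by omega) (by omega) (by omega)
    have n01 := ne 0 1 (by omega) (by omega) (by omega)
    have n12 := ne 1 2 (by omega) (by omega) (by omega)
    have n05 := ne 0 5 (by omega) (by omega) (by omega)
    have n45 := ne 4 5 (by omega) (by omega) (by omega)
    grind [SimpleGraph.Adj.ne, SimpleGraph.Adj.symm]
end

section
/- Let M be a dominating induced matching of a finite graph G and let xy ∈ M. Then: every edge of G with both endpoints in N_2(xy) belongs to M; every vertex of N_2(xy) is an endpoint of an edge of M; no edge with both endpoints in N_3(xy) belongs to M; and no edge with one endpoint in N_3(xy) and the other endpoint in N_4(xy) belongs to M. -/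
open SimpleGraph

namespace SimpleGraph

lemma Adj.dist_le_dist_add_one {V : Type*} {G : SimpleGraph V} {z w a : V} (h : G.Adj z w)
    (hza : G.Reachable z a) : G.dist z a ≤ G.dist w a + 1 := by
  obtain ⟨p, hp⟩ := (h.symm.reachable.trans hza).exists_walk_length_eq_dist
  simpa [hp] using G.dist_le (Walk.cons h p)

lemma exists_adj_dist_le {V : Type*} {G : SimpleGraph V} {z a : V} {k : ℕ}
    (h : G.dist z a = k + 1) : ∃ w, G.Adj z w ∧ G.dist w a ≤ k := by
  obtain ⟨p, hp⟩ := (Reachable.of_dist_ne_zero (h.trans_ne k.succ_ne_zero)).exists_walk_length_eq_dist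
  cases p with
  | nil => simp at h
  | cons hzw q =>
    refine ⟨_, hzw, (G.dist_le q).trans ?_⟩
    simp only [Walk.length_cons] at hp
    omega

end SimpleGraph

/-- Every vertex at level `k + 1` has a neighbour at level `k`. -/
lemma exists_adj_mem_distLevel {V : Type*} {G : SimpleGraph V} {x y z : V} {k : ℕ}
    (h : z ∈ distLevel G x y (k + 1)) : ∃ w ∈ distLevel G x y k, G.Adj z w := by
  simp only [distLevel, Set.mem_ofPred_eq] at h ⊢
  have hx : G.Reachable z x := Reachable.of_dist_ne_zero (by omega)
  have hy : G.Reachable z y := Reachable.of_dist_ne_zero (by omega)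
  have key : ∃ w, G.Adj z w ∧ min (G.dist w x) (G.dist w y) ≤ k := by
    rcases min_choice (G.dist z x) (G.dist z y) with h' | h'
    · obtain ⟨w, hw, hd⟩ := exists_adj_dist_le (h'.symm.trans h)
      exact ⟨w, hw, by omega⟩
    · obtain ⟨w, hw, hd⟩ := exists_adj_dist_le (h'.symm.trans h)
      exact ⟨w, hw, by omega⟩
  obtain ⟨w, hw, hd⟩ := key
  have h1 := hw.dist_le_dist_add_one hx
  have h2 := hw.dist_le_dist_add_one hy
  exact ⟨w, by omega, hw⟩

lemma ne_of_mem_distLevel {V : Type*} {G : SimpleGraph V} {x y a b : V} {i j : ℕ}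
    (ha : a ∈ distLevel G x y i) (hb : b ∈ distLevel G x y j) (hij : i ≠ j) : a ≠ b := by
  rintro rfl
  exact hij (ha.symm.trans hb)

namespace IsDIM

variable {V : Type*} {G : SimpleGraph V} {M : Set (Sym2 V)}

/-- Matching edges meeting the two ends of an edge of `G` coincide. -/
lemma eq_of_adj (hM : IsDIM G M) {a b : V} (hab : G.Adj a b) {e f : Sym2 V}
    (he : e ∈ M) (hf : f ∈ M) (hae : a ∈ e) (hbf : b ∈ f) : e = f :=
  (hM.2 s(a, b) hab).unique ⟨he, a, Sym2.mem_mk_left a b, hae⟩ ⟨hf, b, Sym2.mem_mk_right a b, hbf⟩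

lemma mem_mVerts_or (hM : IsDIM G M) {a b : V} (hab : G.Adj a b) :
    a ∈ MVerts M ∨ b ∈ MVerts M := by
  obtain ⟨f, ⟨hf, v, hv, hvf⟩, -⟩ := hM.2 s(a, b) hab
  rcases Sym2.mem_iff.1 hv with rfl | rfl
  · exact .inl ⟨f, hf, hvf⟩
  · exact .inr ⟨f, hf, hvf⟩

lemma mem_of_adj_s9 (hM : IsDIM G M) {a b : V} (hab : G.Adj a b) (ha : a ∈ MVerts M)
    (hb : b ∈ MVerts M) : s(a, b) ∈ M := by
  obtain ⟨e, he, hae⟩ := ha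
  obtain ⟨f, hf, hbf⟩ := hb
  obtain rfl := hM.eq_of_adj hab he hf hae hbf
  rwa [← (Sym2.mem_and_mem_iff hab.ne).1 ⟨hae, hbf⟩]

lemma notMem_mVerts_of_mem_distLevel_one (hM : IsDIM G M) {x y w : V} (hxy : s(x, y) ∈ M)
    (hw : w ∈ distLevel G x y 1) : w ∉ MVerts M := by
  rintro ⟨f, hf, hwf⟩
  simp only [distLevel, Set.mem_ofPred_eq] at hw
  have hfe : f = s(x, y) := by
    rcases min_choice (G.dist w x) (G.dist w y) with h | h
    · exact hM.eq_of_adj (dist_eq_one_iff_adj.1 (h.symm.trans hw)) hf hxy hwf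
        (Sym2.mem_mk_left x y)
    · exact hM.eq_of_adj (dist_eq_one_iff_adj.1 (h.symm.trans hw)) hf hxy hwf
        (Sym2.mem_mk_right x y)
  rw [hfe, Sym2.mem_iff] at hwf
  rcases hwf with rfl | rfl <;> simp at hw

lemma mem_mVerts_of_mem_distLevel_two (hM : IsDIM G M) {x y v : V} (hxy : s(x, y) ∈ M)
    (hv : v ∈ distLevel G x y 2) : v ∈ MVerts M := by
  obtain ⟨w, hw, hvw⟩ := exists_adj_mem_distLevel hv
  exact (hM.mem_mVerts_or hvw).resolve_right (hM.notMem_mVerts_of_mem_distLevel_one hxy hw)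

lemma notMem_of_mem_distLevel_three (hM : IsDIM G M) {x y a b : V} {j : ℕ} (hxy : s(x, y) ∈ M)
    (ha : a ∈ distLevel G x y 3) (hb : b ∈ distLevel G x y j) (hj : 2 ≠ j) : s(a, b) ∉ M := by
  intro hab
  obtain ⟨c, hc, hac⟩ := exists_adj_mem_distLevel ha
  obtain ⟨f, hf, hcf⟩ := hM.mem_mVerts_of_mem_distLevel_two hxy hc
  rw [← hM.eq_of_adj hac hab hf (Sym2.mem_mk_left a b) hcf, Sym2.mem_iff] at hcf
  exact hcf.elim hac.ne' (ne_of_mem_distLevel hc hb hj)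

end IsDIM

/-- for a d.i.m. `M` with `xy ∈ M`: every edge inside `N₂(xy)` is in `M`;
every vertex of `N₂(xy)` is an endpoint of an `M`-edge; no edge inside `N₃(xy)` is in `M`;
and no edge between `N₃(xy)` and `N₄(xy)` is in `M`. -/
theorem stmt9 {V : Type*} [Fintype V] (G : SimpleGraph V) (M : Set (Sym2 V))
    (hM : IsDIM G M) (x y : V) (hxy : s(x, y) ∈ M) :
    (∀ a b : V, a ∈ distLevel G x y 2 → b ∈ distLevel G x y 2 → G.Adj a b →
      s(a, b) ∈ M) ∧
    (∀ v ∈ distLevel G x y 2, v ∈ MVerts M) ∧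
    (∀ a b : V, a ∈ distLevel G x y 3 → b ∈ distLevel G x y 3 → s(a, b) ∉ M) ∧
    (∀ a b : V, a ∈ distLevel G x y 3 → b ∈ distLevel G x y 4 → s(a, b) ∉ M) := by
  exact ⟨fun a b ha hb hab ↦ hM.mem_of_adj_s9 hab (hM.mem_mVerts_of_mem_distLevel_two hxy ha)
      (hM.mem_mVerts_of_mem_distLevel_two hxy hb),
    fun v hv ↦ hM.mem_mVerts_of_mem_distLevel_two hxy hv,
    fun a b ha hb ↦ hM.notMem_of_mem_distLevel_three hxy ha hb (by decide),
    fun a b ha hb ↦ hM.notMem_of_mem_distLevel_three hxy ha hb (by decide)⟩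
end

section
/- Let M be a dominating induced matching of a finite graph G and let xy ∈ M. If a ∈ N_3(xy) and b,c ∈ N_4(xy) are vertices with ab, ac, bc ∈ E (a triangle with one vertex in N_3 and two vertices in N_4), then bc ∈ M. -/
open SimpleGraph

/-- Two `M`-edges meeting the two ends of an edge of `G` coincide. -/
theorem IsDIM.eq_of_adj_s10 {V : Type*} {G : SimpleGraph V} {M : Set (Sym2 V)} (hM : IsDIM G M)
    {u v : V} (huv : G.Adj u v) {e f : Sym2 V} (he : e ∈ M) (hf : f ∈ M)
    (hue : u ∈ e) (hvf : v ∈ f) : e = f :=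
  (hM.2 s(u, v) huv).unique ⟨he, u, Sym2.mem_mk_left u v, hue⟩
    ⟨hf, v, Sym2.mem_mk_right u v, hvf⟩

/-- `V(M)` is a vertex cover of `G`. -/
theorem IsDIM.mem_MVerts_or {V : Type*} {G : SimpleGraph V} {M : Set (Sym2 V)} (hM : IsDIM G M)
    {u v : V} (huv : G.Adj u v) : u ∈ MVerts M ∨ v ∈ MVerts M := by
  obtain ⟨f, ⟨hf, w, hw, hwf⟩, -⟩ := hM.2 s(u, v) huv
  rcases Sym2.mem_iff.1 hw with rfl | rfl
  · exact Or.inl ⟨f, hf, hwf⟩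
  · exact Or.inr ⟨f, hf, hwf⟩

/-- A neighbour of `x` other than its `M`-partner `y` is not in `V(M)`. -/
theorem IsDIM.notMem_MVerts {V : Type*} {G : SimpleGraph V} {M : Set (Sym2 V)} (hM : IsDIM G M)
    {x y q : V} (hxy : s(x, y) ∈ M) (hqx : G.Adj q x) (hqy : q ≠ y) : q ∉ MVerts M := by
  rintro ⟨f, hf, hqf⟩
  obtain rfl := hM.eq_of_adj_s10 hqx hf hxy hqf (Sym2.mem_mk_left x y)
  rcases Sym2.mem_iff.1 hqf with h | h
  · exact hqx.ne h
  · exact hqy h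

/-- If a vertex `a` of a triangle `abc` is not in `V(M)`, then `bc ∈ M`. -/
theorem IsDIM.mem_of_triangle {V : Type*} {G : SimpleGraph V} {M : Set (Sym2 V)}
    (hM : IsDIM G M) {a b c : V} (hab : G.Adj a b) (hac : G.Adj a c) (hbc : G.Adj b c)
    (ha : a ∉ MVerts M) : s(b, c) ∈ M := by
  obtain ⟨e, he, hbe⟩ := (hM.mem_MVerts_or hab).resolve_left ha
  obtain ⟨f, hf, hcf⟩ := (hM.mem_MVerts_or hac).resolve_left ha
  obtain rfl := hM.eq_of_adj_s10 hbc he hf hbe hcf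
  rwa [← (Sym2.mem_and_mem_iff hbc.ne).1 ⟨hbe, hcf⟩]

/-- In a triangle `abc`, the edge of `M` at a vertex `a ∈ V(M)` joins `a` to `b` or `c`. -/
theorem IsDIM.mem_or_mem_of_triangle {V : Type*} {G : SimpleGraph V} {M : Set (Sym2 V)}
    (hM : IsDIM G M) {a b c : V} (hab : G.Adj a b) (hac : G.Adj a c) (hbc : G.Adj b c)
    {e : Sym2 V} (he : e ∈ M) (hae : a ∈ e) : b ∈ e ∨ c ∈ e := by
  rcases hM.mem_MVerts_or hbc with ⟨f, hf, h⟩ | ⟨f, hf, h⟩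
  · exact Or.inl (hM.eq_of_adj_s10 hab he hf hae h ▸ h)
  · exact Or.inr (hM.eq_of_adj_s10 hac he hf hae h ▸ h)

/-- The triangle property when `x` is the end of `xy` at distance three from `a`. -/
theorem IsDIM.mem_of_triangle_of_dist_eq_three {V : Type*} {G : SimpleGraph V}
    {M : Set (Sym2 V)} (hM : IsDIM G M) {x y a b c : V} (hxy : s(x, y) ∈ M)
    (hax : G.dist a x = 3) (hay : 3 ≤ G.dist a y)
    (hb : 3 ≤ G.dist b x) (hc : 3 ≤ G.dist c x)
    (hab : G.Adj a b) (hac : G.Adj a c) (hbc : G.Adj b c) : s(b, c) ∈ M := by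
  have hreach : G.Reachable a x := by
    by_contra h
    simp [SimpleGraph.dist_eq_zero_of_not_reachable h] at hax
  obtain ⟨w, hw⟩ := hreach.exists_walk_length_eq_dist
  rw [hax] at hw
  obtain ⟨p, q, hap, hpq, hqx⟩ : ∃ p q, G.Adj a p ∧ G.Adj p q ∧ G.Adj q x := by
    match w, hw with
    | .cons h₁ (.cons h₂ (.cons h₃ .nil)), _ => exact ⟨_, _, h₁, h₂, h₃⟩
  have hqy : q ≠ y := by
    rintro rfl
    have := SimpleGraph.dist_le (Walk.cons hap (Walk.cons hpq Walk.nil))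
    simp at this
    omega
  have hpx : G.dist p x ≤ 2 := by
    simpa using SimpleGraph.dist_le (Walk.cons hpq (Walk.cons hqx Walk.nil))
  obtain ⟨f, hf, hpf⟩ := (hM.mem_MVerts_or hpq).resolve_right (hM.notMem_MVerts hxy hqx hqy)
  refine hM.mem_of_triangle hab hac hbc ?_
  rintro ⟨e, he, hae⟩
  obtain rfl := hM.eq_of_adj_s10 hap he hf hae hpf
  obtain rfl := (Sym2.mem_and_mem_iff hap.ne).1 ⟨hae, hpf⟩
  rcases hM.mem_or_mem_of_triangle hab hac hbc he hae with h | h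
  · rcases Sym2.mem_iff.1 h with rfl | rfl
    · exact hab.ne rfl
    · omega
  · rcases Sym2.mem_iff.1 h with rfl | rfl
    · exact hac.ne rfl
    · omega

/-- for a d.i.m. `M` with `xy ∈ M`, in any triangle with one vertex
`a ∈ N₃(xy)` and two vertices `b, c ∈ N₄(xy)`, the edge `bc` is in `M`. -/
theorem stmt10 {V : Type*} [Fintype V] (G : SimpleGraph V) (M : Set (Sym2 V))
    (hM : IsDIM G M) (x y : V) (hxy : s(x, y) ∈ M)
    (a b c : V) (ha : a ∈ distLevel G x y 3)
    (hb : b ∈ distLevel G x y 4) (hc : c ∈ distLevel G x y 4)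
    (hab : G.Adj a b) (hac : G.Adj a c) (hbc : G.Adj b c) :
    s(b, c) ∈ M := by
  simp only [distLevel, Set.mem_ofPred_eq] at ha hb hc
  rcases min_choice (G.dist a x) (G.dist a y) with h | h
  · exact hM.mem_of_triangle_of_dist_eq_three hxy (by omega) (by omega) (by omega) (by omega)
      hab hac hbc
  · exact hM.mem_of_triangle_of_dist_eq_three (Sym2.eq_swap ▸ hxy) (by omega) (by omega)
      (by omega) (by omega) hab hac hbc
end

section
/- Under the standing setup and with the sets T_i and S_3 as defined, assume additionally that N_4(xy) = ∅. Then: (i) for every edge vw with v,w ∈ N_3, v adjacent to u_i and w adjacent to u_j, the set {v,w} ∩ {u'_i, u'_j} has exactly one element; (ii) for every edge st with s ∈ S_3 and t ∈ T_i, one has t = u'_i (so u_i t ∈ M). -/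
open SimpleGraph

/-- Two edges of a d.i.m. that both meet a common edge of `G` coincide. -/
theorem IsDIM.eq_of_adj_s13 {V : Type*} {G : SimpleGraph V} {M : Set (Sym2 V)} (hM : IsDIM G M)
    {a b : V} (hab : G.Adj a b) {f g : Sym2 V} (hf : f ∈ M) (hg : g ∈ M)
    (haf : a ∈ f ∨ b ∈ f) (hag : a ∈ g ∨ b ∈ g) : f = g := by
  refine (hM.2 s(a, b) hab).unique ⟨hf, ?_⟩ ⟨hg, ?_⟩
  · rcases haf with h | h
    exacts [⟨a, by simp, h⟩, ⟨b, by simp, h⟩]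
  · rcases hag with h | h
    exacts [⟨a, by simp, h⟩, ⟨b, by simp, h⟩]

/-- Every edge of `G` has an endpoint in `V(M)`. -/
theorem IsDIM.mem_mVerts_or_mem_mVerts {V : Type*} {G : SimpleGraph V} {M : Set (Sym2 V)}
    (hM : IsDIM G M) {a b : V} (hab : G.Adj a b) : a ∈ MVerts M ∨ b ∈ MVerts M := by
  obtain ⟨f, ⟨hf, v, hv, hvf⟩, -⟩ := hM.2 s(a, b) hab
  rcases Sym2.mem_iff.1 hv with rfl | rfl
  exacts [Or.inl ⟨f, hf, hvf⟩, Or.inr ⟨f, hf, hvf⟩]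

/-- A matched vertex adjacent to an endpoint `a` of an edge `ab ∈ M` is `b`. -/
theorem IsDIM.eq_mate {V : Type*} {G : SimpleGraph V} {M : Set (Sym2 V)} (hM : IsDIM G M)
    {v a b : V} (hv : v ∈ MVerts M) (hab : s(a, b) ∈ M) (hva : G.Adj v a) : v = b := by
  obtain ⟨f, hf, hvf⟩ := hv
  obtain rfl := hM.eq_of_adj_s13 hva hf hab (Or.inl hvf) (Or.inr (by simp))
  exact (Sym2.mem_iff.1 hvf).resolve_left hva.ne

/-- A vertex on level `i + 1` has a neighbour on level `i`. -/
theorem exists_adj_distLevel {V : Type*} {G : SimpleGraph V} (hconn : G.Connected)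
    {x y s : V} {i : ℕ} (hs : s ∈ distLevel G x y (i + 1)) :
    ∃ n, G.Adj s n ∧ n ∈ distLevel G x y i := by
  have closer : ∀ a b : V, G.dist s a = i + 1 → i + 1 ≤ G.dist s b →
      ∃ n, G.Adj s n ∧ min (G.dist n a) (G.dist n b) = i := by
    intro a b ha hb
    obtain ⟨p, hp⟩ := hconn.exists_walk_length_eq_dist s a
    cases p with
    | nil => simp at ha
    | @cons _ n _ h q =>
      refine ⟨n, h, ?_⟩
      have hsn : G.dist s n = 1 := dist_eq_one_iff_adj.2 h
      have hq := dist_le q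
      have hsa := hconn.dist_triangle (u := s) (v := n) (w := a)
      have hsb := hconn.dist_triangle (u := s) (v := n) (w := b)
      rw [Walk.length_cons] at hp
      omega
  have hs' : min (G.dist s x) (G.dist s y) = i + 1 := hs
  rcases le_total (G.dist s x) (G.dist s y) with h | h
  · exact closer x y (by omega) (by omega)
  · obtain ⟨n, hn, hd⟩ := closer y x (by omega) (by omega)
    exact ⟨n, hn, by rwa [min_comm] at hd⟩

/-- Lemma 2: assuming `N₄(xy) = ∅`: (i) for every edge `vw` inside `N₃`
with `v` adjacent to `u_i` and `w` adjacent to `u_j`, exactly one element of `{v,w}` lies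
in `{u'_i, u'_j}`; (ii) every edge `st` with `s ∈ S₃` and `t ∈ T_i` satisfies `t = u'_i`. -/
theorem stmt13 {V : Type*} [Fintype V] [DecidableEq V]
    (G : SimpleGraph V) (hconn : G.Connected)
    (hP8 : IsEmpty (SimpleGraph.pathGraph 8 ↪g G))
    (hK4 : IsEmpty ((⊤ : SimpleGraph (Fin 4)) ↪g G))
    (hDia : IsEmpty (diamondGraph ↪g G))
    (hBut : IsEmpty (butterflyGraph ↪g G))
    (M : Set (Sym2 V)) (hM : IsDIM G M)
    (x y : V) (hxy : s(x, y) ∈ M)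
    (r : V) (hrx : G.Adj r x) (hry : r ≠ y) (hrny : ¬ G.Adj r y)
    (hN2M : ∀ a b : V, a ∈ distLevel G x y 2 → b ∈ distLevel G x y 2 → s(a, b) ∉ M)
    (k : ℕ) (u : Fin k → V) (huinj : Function.Injective u)
    (hurange : Set.range u = distLevel G x y 2)
    (u' : Fin k → V) (hu3 : ∀ i, u' i ∈ distLevel G x y 3)
    (huM : ∀ i, s(u i, u' i) ∈ M)
    (hN4 : distLevel G x y 4 = ∅) :
    (∀ v w : V, v ∈ distLevel G x y 3 → w ∈ distLevel G x y 3 → G.Adj v w →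
      ∀ i j : Fin k, G.Adj v (u i) → G.Adj w (u j) →
      ∃! z : V, (z = v ∨ z = w) ∧ (z = u' i ∨ z = u' j)) ∧
    (∀ s t : V, s ∈ distLevel G x y 3 \ ⋃ i : Fin k, Tset G x y (u i) →
      ∀ i : Fin k, t ∈ Tset G x y (u i) → G.Adj s t → t = u' i) := by
  have hmem : ∀ i, u i ∈ distLevel G x y 2 := fun i => hurange ▸ Set.mem_range_self i
  have hne : ∀ i j, u i ≠ u' j := by
    intro i j h
    have h2 : min _ _ = 2 := hmem i
    have h3 : min _ _ = 3 := hu3 j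
    rw [h] at h2
    omega
  have hinj : ∀ i j, s(u i, u' i) = s(u j, u' j) → i = j := by
    intro i j h
    rcases Sym2.eq_iff.1 h with h | h
    exacts [huinj h.1, (hne _ _ h.1).elim]
  have hmate : ∀ {v i}, v ∈ MVerts M → G.Adj v (u i) → v = u' i :=
    fun hv h => hM.eq_mate hv (huM _) h
  have hu'M : ∀ i, u' i ∈ MVerts M := fun i => ⟨_, huM i, by simp⟩
  constructor
  · intro v w _ _ hvw i j hvi hwj
    have hnot : ¬ (v ∈ MVerts M ∧ w ∈ MVerts M) := by
      rintro ⟨hv, hw⟩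
      have hvi' := hmate hv hvi
      have hwj' := hmate hw hwj
      have hij := hinj i j (hM.eq_of_adj_s13 hvw (huM i) (huM j)
        (Or.inl (by simp [hvi'])) (Or.inr (by simp [hwj'])))
      exact hvw.ne (by rw [hvi', hwj', hij])
    have hmatched : ∀ z, z = u' i ∨ z = u' j → z ∈ MVerts M := by
      rintro z (rfl | rfl) <;> exact hu'M _
    rcases hM.mem_mVerts_or_mem_mVerts hvw with hv | hw
    · refine ⟨v, ⟨Or.inl rfl, Or.inl (hmate hv hvi)⟩, ?_⟩
      rintro z ⟨rfl | rfl, hz⟩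
      exacts [rfl, (hnot ⟨hv, hmatched _ hz⟩).elim]
    · refine ⟨w, ⟨Or.inr rfl, Or.inr (hmate hw hwj)⟩, ?_⟩
      rintro z ⟨rfl | rfl, hz⟩
      exacts [(hnot ⟨hmatched _ hz, hw⟩).elim, rfl]
  · rintro s t ⟨hs3, hsT⟩ i ⟨_, htN⟩ hst
    have hti : G.Adj t (u i) := (htN.symm ▸ Set.mem_singleton (u i) :
      u i ∈ G.neighborSet t ∩ distLevel G x y 2).1
    refine (hM.mem_mVerts_or_mem_mVerts hst).elim (fun hs => ?_) (fun ht => hmate ht hti)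
    obtain ⟨n, hsn, hn⟩ := exists_adj_distLevel hconn hs3
    obtain ⟨j, rfl⟩ : n ∈ Set.range u := hurange ▸ hn
    refine (hsT (Set.mem_iUnion.2 ⟨j, hs3, Set.eq_singleton_iff_unique_mem.2 ⟨⟨hsn, hn⟩, ?_⟩⟩)).elim
    rintro m ⟨hsm, hm⟩
    obtain ⟨l, rfl⟩ : m ∈ Set.range u := hurange ▸ hm
    have hl : s = u' l := hmate hs hsm
    have hj : s = u' j := hmate hs hsn
    rw [hinj l j (hM.eq_of_adj_s13 hst (huM l) (huM j)
      (Or.inl (by simp [← hl])) (Or.inl (by simp [← hj])))]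
end
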